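/- Let (a,b) ∈ ℝ/ℤ × [0,1] and suppose f_{a,b} has an attracting periodic orbit. Then the semiconjugacy φ_{a,b} is constant on each connected component of the immediate basin of attraction. -/

import Mathlib

open Set Filter Topology

noncomputable section

/-- Representative of a point of the circle in `[0,1)`. -/
noncomputable def rep (z : UnitAddCircle) : ℝ := (AddCircle.equivIco 1 0 z).val

/-- The straight sine map on `[0,1)`. -/
noncomputable def Sfun (t : ℝ) : ℝ := if t ≤ 1/2 then 4*t - 1 else -4*t + 3

/-- The piecewise linear perturbation of the doubling map. -/
noncomputable def plpdm (a : UnitAddCircle) (b : ℝ) (z : UnitAddCircle) : UnitAddCircle :=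
  ((2 * rep z + (b/2) * Sfun (rep z) : ℝ) : UnitAddCircle) + a

/-- The doubling map. -/
def Dbl (z : UnitAddCircle) : UnitAddCircle := z + z

/-- `x` is an attracting periodic point of `f` of exact period `n`. -/
def IsAttractingPeriodicPt (f : UnitAddCircle → UnitAddCircle) (n : ℕ)
    (x : UnitAddCircle) : Prop :=
  0 < n ∧ f^[n] x = x ∧ (∀ m, 0 < m → m < n → f^[m] x ≠ x) ∧
  ∃ U : Set UnitAddCircle, IsOpen U ∧ IsConnected U ∧ x ∈ U ∧ f^[n] '' U ⊆ U ∧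
    ∀ y ∈ U, Tendsto (fun k => f^[n*k] y) atTop (nhds x)

/-- Forward orbit of `x` under `f`. -/
def orbitSet (f : UnitAddCircle → UnitAddCircle) (x : UnitAddCircle) : Set UnitAddCircle :=
  {y | ∃ i, f^[i] x = y}

/-- Basin of attraction of the set `O`. -/
def basin (f : UnitAddCircle → UnitAddCircle) (O : Set UnitAddCircle) : Set UnitAddCircle :=
  {y | Tendsto (fun k => Metric.infDist (f^[k] y) O) atTop (nhds 0)}

/-- Immediate basin of attraction of the orbit `O`. -/
def immBasin (f : UnitAddCircle → UnitAddCircle) (O : Set UnitAddCircle) :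
    Set UnitAddCircle :=
  ⋃ z ∈ O, connectedComponentIn (basin f O) z

/-- The hyperbolic set `H`. -/
def hypSet : Set (UnitAddCircle × ℝ) :=
  {q | q.2 ∈ Set.Ico (0:ℝ) 1 ∧ ∃ n x, IsAttractingPeriodicPt (plpdm q.1 q.2) n x}

/-- The lift `F_{a,b}` of `f_{a,b}`, normalized so that `F_{a,b}(0) ∈ [0,1)`. -/
noncomputable def liftF (a : UnitAddCircle) (b : ℝ) (x : ℝ) : ℝ :=
  (2 * Int.fract x + rep a + (b/2) * Sfun (Int.fract x)
    + (if rep a - b/2 < 0 then 1 else 0)) + 2 * (⌊x⌋ : ℝ)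

/-- `Φ_{a,b}`, the limit of `F_{a,b}^n(x)/2^n`. -/
noncomputable def Phi (a : UnitAddCircle) (b : ℝ) (x : ℝ) : ℝ :=
  limUnder atTop (fun n : ℕ => (liftF a b)^[n] x / 2 ^ n)

/-- The semiconjugacy `φ_{a,b}` induced by `Φ_{a,b}`. -/
noncomputable def phiMap (a : UnitAddCircle) (b : ℝ) (z : UnitAddCircle) : UnitAddCircle :=
  ((Phi a b (rep z) : ℝ) : UnitAddCircle)

/-- The arc `I₊ = [0,1/2]` of the circle. -/
def Iplus : Set UnitAddCircle := (fun t : ℝ => (t : UnitAddCircle)) '' Set.Icc 0 (1/2)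

/-- The arc `I₋ = [1/2,1]` of the circle. -/
def Iminus : Set UnitAddCircle := (fun t : ℝ => (t : UnitAddCircle)) '' Set.Icc (1/2) 1

/-- The orbit of `x` (of period `p`) avoids `0`, `1/2` and has slope itinerary `σ`,
where `σ j = true` encodes the symbol `−` and `σ j = false` encodes `+`. -/
def HasItinerary (f : UnitAddCircle → UnitAddCircle) (p : ℕ) (x : UnitAddCircle)
    (σ : Fin p → Bool) : Prop :=
  (∀ j : Fin p, f^[(j : ℕ)] x ≠ (0 : UnitAddCircle) ∧
      f^[(j : ℕ)] x ≠ (((1:ℝ)/2 : ℝ) : UnitAddCircle)) ∧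
  ∀ j : Fin p, (σ j = true → f^[(j : ℕ)] x ∈ Iminus) ∧ (σ j = false → f^[(j : ℕ)] x ∈ Iplus)

/-- The set `P_σ` of parameters whose attracting orbit has slope itinerary `σ`. -/
def paramSet (p : ℕ) (σ : Fin p → Bool) : Set (UnitAddCircle × ℝ) :=
  {q | q.2 ∈ Set.Ico (0:ℝ) 1 ∧ ∃ x, IsAttractingPeriodicPt (plpdm q.1 q.2) p x ∧
       HasItinerary (plpdm q.1 q.2) p x σ}

/-- `S` is a tongue: its closure meets `ℝ/ℤ × {1}` in a nondegenerate interval. -/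
def IsTongue (S : Set (UnitAddCircle × ℝ)) : Prop :=
  ∃ u v : ℝ, u < v ∧ ∀ t ∈ Set.Icc u v, (((t : ℝ) : UnitAddCircle), (1:ℝ)) ∈ closure S

end

/-- The constant term of the normalized lift. -/
noncomputable def liftShift (a : UnitAddCircle) (b : ℝ) : ℝ :=
  rep a + (if rep a - b / 2 < 0 then 1 else 0)

theorem coe_rep (z : UnitAddCircle) : ((rep z : ℝ) : UnitAddCircle) = z :=
  AddCircle.coe_equivIco

theorem rep_coe (t : ℝ) : rep (t : UnitAddCircle) = Int.fract t := by
  have h : ((Int.fract t : ℝ) : UnitAddCircle) = t := by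
    rw [← sub_eq_zero, ← AddCircle.coe_sub, AddCircle.coe_eq_zero_iff]
    exact ⟨-⌊t⌋, by rw [Int.fract]; simp⟩
  rw [← h]
  exact AddCircle.equivIco_coe_of_mem
    ⟨Int.fract_nonneg t, by simpa using Int.fract_lt_one t⟩

theorem coe_add_intCast (t : ℝ) (m : ℤ) : ((t + m : ℝ) : UnitAddCircle) = t := by
  rw [AddCircle.coe_add, add_eq_left, AddCircle.coe_eq_zero_iff]
  exact ⟨m, by simp⟩

theorem continuous_Sfun_fract : Continuous fun x : ℝ => Sfun (Int.fract x) := by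
  have h : Continuous Sfun := by
    unfold Sfun
    refine Continuous.if_le (by fun_prop) (by fun_prop) (by fun_prop) (by fun_prop) ?_
    intro x hx
    linarith
  exact h.continuousOn.comp_fract'' (by norm_num [Sfun])

theorem abs_Sfun_fract_le (x : ℝ) : |Sfun (Int.fract x)| ≤ 1 := by
  have h0 := Int.fract_nonneg x
  have h1 := (Int.fract_lt_one x).le
  unfold Sfun
  split_ifs with h
  · exact abs_le.2 ⟨by linarith, by linarith⟩
  · push Not at h
    exact abs_le.2 ⟨by linarith, by linarith⟩

theorem liftF_eq (a : UnitAddCircle) (b x : ℝ) :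
    liftF a b x = 2 * x + (liftShift a b + b / 2 * Sfun (Int.fract x)) := by
  have h := Int.floor_add_fract x
  simp only [liftF, liftShift]
  linear_combination 2 * h

theorem continuous_liftF (a : UnitAddCircle) (b : ℝ) : Continuous (liftF a b) := by
  have h := continuous_Sfun_fract
  simp only [funext (liftF_eq a b)]
  fun_prop

theorem liftF_add_intCast (a : UnitAddCircle) (b x : ℝ) (m : ℤ) :
    liftF a b (x + m) = liftF a b x + (2 * m : ℤ) := by
  simp only [liftF_eq, Int.fract_add_intCast]
  push_cast
  ring

theorem liftF_iterate_add_intCast (a : UnitAddCircle) (b x : ℝ) (m : ℤ) (n : ℕ) :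
    (liftF a b)^[n] (x + m) = (liftF a b)^[n] x + 2 ^ n * m := by
  induction n generalizing x m with
  | zero => simp
  | succ n ih =>
    rw [Function.iterate_succ_apply, liftF_add_intCast, ih, Function.iterate_succ_apply]
    push_cast
    ring

theorem coe_liftF (a : UnitAddCircle) (b x : ℝ) :
    ((liftF a b x : ℝ) : UnitAddCircle) = plpdm a b x := by
  obtain ⟨k, hk⟩ : ∃ k : ℤ, (if rep a - b / 2 < 0 then (1 : ℝ) else 0) = k := by
    split_ifs
    · exact ⟨1, by simp⟩
    · exact ⟨0, by simp⟩
  have h : liftF a b x =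
      (2 * Int.fract x + b / 2 * Sfun (Int.fract x) + rep a) + ((k + 2 * ⌊x⌋ : ℤ) : ℝ) := by
    simp only [liftF, hk]
    push_cast
    ring
  rw [h, coe_add_intCast, AddCircle.coe_add, coe_rep, plpdm, rep_coe]

/-- The `k`-th term of the telescoping series for `Φ_{a,b} - id`. -/
noncomputable def phiTerm (a : UnitAddCircle) (b : ℝ) (k : ℕ) (x : ℝ) : ℝ :=
  (liftShift a b + b / 2 * Sfun (Int.fract ((liftF a b)^[k] x))) / 2 ^ (k + 1)

theorem liftF_iterate_div_eq_sum (a : UnitAddCircle) (b x : ℝ) (n : ℕ) :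
    (liftF a b)^[n] x / 2 ^ n = x + ∑ k ∈ Finset.range n, phiTerm a b k x := by
  induction n with
  | zero => simp
  | succ n ih =>
    rw [Finset.sum_range_succ, ← add_assoc, ← ih, Function.iterate_succ_apply', liftF_eq, phiTerm]
    field_simp
    ring

theorem norm_phiTerm_le (a : UnitAddCircle) (b : ℝ) (k : ℕ) (x : ℝ) :
    ‖phiTerm a b k x‖ ≤ (|liftShift a b| + |b / 2|) * (1 / 2) ^ k := by
  rw [phiTerm, norm_div, Real.norm_eq_abs, norm_pow, Real.norm_two, one_div, inv_pow,
    ← div_eq_mul_inv]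
  refine div_le_div₀ (by positivity) ?_ (by positivity) ?_
  · refine (abs_add_le _ _).trans ?_
    rw [abs_mul]
    gcongr
    exact mul_le_of_le_one_right (abs_nonneg _) (abs_Sfun_fract_le _)
  · exact pow_le_pow_right₀ one_le_two (Nat.le_succ k)

theorem summable_phiTerm_bound (c : ℝ) : Summable fun k : ℕ => c * (1 / 2 : ℝ) ^ k :=
  summable_geometric_two.mul_left c

theorem tendsto_liftF_iterate_div (a : UnitAddCircle) (b x : ℝ) :
    Tendsto (fun n : ℕ => (liftF a b)^[n] x / 2 ^ n) atTop
      (𝓝 (x + ∑' k, phiTerm a b k x)) := by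
  simp only [liftF_iterate_div_eq_sum]
  exact ((Summable.of_norm_bounded (summable_phiTerm_bound _)
    fun k => norm_phiTerm_le a b k x).hasSum.tendsto_sum_nat).const_add x

theorem tendsto_Phi (a : UnitAddCircle) (b x : ℝ) :
    Tendsto (fun n : ℕ => (liftF a b)^[n] x / 2 ^ n) atTop (𝓝 (Phi a b x)) :=
  tendsto_nhds_limUnder ⟨_, tendsto_liftF_iterate_div a b x⟩

theorem continuous_Phi (a : UnitAddCircle) (b : ℝ) : Continuous (Phi a b) := by
  have h : Phi a b = fun x => x + ∑' k, phiTerm a b k x :=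
    funext fun x => tendsto_nhds_unique (tendsto_Phi a b x) (tendsto_liftF_iterate_div a b x)
  rw [h]
  refine continuous_id.add (continuous_tsum (fun k => ?_) (summable_phiTerm_bound _)
    (norm_phiTerm_le a b))
  have := continuous_Sfun_fract.comp ((continuous_liftF a b).iterate k)
  simp only [Function.comp_def] at this
  unfold phiTerm
  fun_prop

theorem Phi_liftF (a : UnitAddCircle) (b x : ℝ) : Phi a b (liftF a b x) = 2 * Phi a b x := by
  refine tendsto_nhds_unique (tendsto_Phi a b _) ?_
  refine (((tendsto_Phi a b x).comp (tendsto_add_atTop_nat 1)).const_mul 2).congr fun n => ?_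
  simp only [Function.comp_apply, Function.iterate_succ_apply, pow_succ]
  field_simp

theorem Phi_add_intCast (a : UnitAddCircle) (b x : ℝ) (m : ℤ) :
    Phi a b (x + m) = Phi a b x + m := by
  refine tendsto_nhds_unique (tendsto_Phi a b _) ?_
  refine ((tendsto_Phi a b x).add_const (m : ℝ)).congr fun n => ?_
  rw [liftF_iterate_add_intCast]
  field_simp

theorem phiMap_coe (a : UnitAddCircle) (b t : ℝ) :
    phiMap a b t = ((Phi a b t : ℝ) : UnitAddCircle) := by
  conv_rhs => rw [← Int.fract_add_floor t, Phi_add_intCast, coe_add_intCast]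
  rw [phiMap, rep_coe]

theorem continuous_phiMap (a : UnitAddCircle) (b : ℝ) : Continuous (phiMap a b) := by
  refine (QuotientAddGroup.isOpenQuotientMap_mk.isQuotientMap).continuous_iff.2 ?_
  have h : phiMap a b ∘ (QuotientAddGroup.mk : ℝ → UnitAddCircle) =
      fun t => ((Phi a b t : ℝ) : UnitAddCircle) := funext (phiMap_coe a b)
  rw [h]
  exact (AddCircle.continuous_mk' 1).comp (continuous_Phi a b)

theorem phiMap_semiconj (a : UnitAddCircle) (b : ℝ) :
    Function.Semiconj (phiMap a b) (plpdm a b) Dbl := by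
  intro z
  obtain ⟨t, rfl⟩ := QuotientAddGroup.mk_surjective z
  have h := phiMap_coe a b (liftF a b t)
  rw [coe_liftF, Phi_liftF, two_mul, AddCircle.coe_add, ← phiMap_coe] at h
  exact h

theorem Dbl_iterate (k : ℕ) (w : UnitAddCircle) : Dbl^[k] w = 2 ^ k • w := by
  induction k with
  | zero => simp
  | succ k ih => rw [Function.iterate_succ_apply', ih, Dbl, pow_succ, mul_comm, mul_smul, two_nsmul]

theorem phiMap_iterate (a : UnitAddCircle) (b : ℝ) (k : ℕ) (z : UnitAddCircle) :
    phiMap a b ((plpdm a b)^[k] z) = 2 ^ k • phiMap a b z := by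
  rw [(phiMap_semiconj a b).iterate_right k z, Dbl_iterate]

theorem UnitAddCircle.norm_add_self {v : UnitAddCircle} (hv : ‖v‖ < 1 / 4) :
    ‖v + v‖ = 2 * ‖v‖ := by
  obtain ⟨t, rfl⟩ := QuotientAddGroup.mk_surjective v
  change ‖(t : UnitAddCircle)‖ < 1 / 4 at hv
  change ‖(t : UnitAddCircle) + (t : UnitAddCircle)‖ = 2 * ‖(t : UnitAddCircle)‖
  have ht : ((t - round t : ℝ) : UnitAddCircle) = t := by simp
  rw [UnitAddCircle.norm_eq] at hv ⊢
  rw [← ht, ← AddCircle.coe_add, ← two_mul, (AddCircle.norm_coe_eq_abs_iff 1 one_ne_zero).2,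
    abs_mul, abs_two]
  rw [abs_mul, abs_two, abs_one]
  linarith

/-- A point of the circle whose orbit under doubling tends to `0` is a dyadic torsion point. -/
theorem exists_two_pow_nsmul_eq_zero {w : UnitAddCircle}
    (h : Tendsto (fun k : ℕ => 2 ^ k • w) atTop (𝓝 0)) : ∃ k : ℕ, 2 ^ k • w = 0 := by
  obtain ⟨K, hK⟩ := eventually_atTop.1
    ((tendsto_zero_iff_norm_tendsto_zero.1 h).eventually_lt_const
      (show (0 : ℝ) < 1 / 4 by norm_num))
  refine ⟨K, ?_⟩
  have hgrow (j : ℕ) : ‖(2 ^ (K + j) : ℕ) • w‖ = 2 ^ j * ‖(2 ^ K : ℕ) • w‖ := by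
    induction j with
    | zero => simp
    | succ j ih =>
      rw [← add_assoc, pow_succ, mul_comm, mul_smul, two_nsmul,
        UnitAddCircle.norm_add_self (hK _ (Nat.le_add_right K j)), ih]
      ring
  by_contra hne
  obtain ⟨j, hj⟩ := pow_unbounded_of_one_lt (1 / 4 / ‖(2 ^ K : ℕ) • w‖) one_lt_two
  rw [div_lt_iff₀ (norm_pos_iff.2 hne), ← hgrow] at hj
  exact (hK _ (Nat.le_add_right K j)).not_gt hj

theorem nsmul_phiMap_eq_zero_of_mem_orbitSet {a : UnitAddCircle} {b : ℝ} {n : ℕ}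
    {x z : UnitAddCircle} (hx : (plpdm a b)^[n] x = x) (hz : z ∈ orbitSet (plpdm a b) x) :
    (2 ^ n - 1) • phiMap a b z = 0 := by
  obtain ⟨i, rfl⟩ := hz
  have h := phiMap_iterate a b n ((plpdm a b)^[i] x)
  rw [← Function.iterate_add_apply, add_comm, Function.iterate_add_apply, hx] at h
  rw [sub_nsmul _ Nat.one_le_two_pow, ← h]
  simp

theorem exists_nsmul_phiMap_eq_zero_of_mem_basin {a : UnitAddCircle} {b : ℝ} {n : ℕ}
    (hn : 0 < n) {x y : UnitAddCircle} (hx : (plpdm a b)^[n] x = x)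
    (hy : y ∈ basin (plpdm a b) (orbitSet (plpdm a b) x)) :
    ∃ N : ℕ, 0 < N ∧ N • phiMap a b y = 0 := by
  set m := 2 ^ n - 1
  have hm : 0 < m := Nat.sub_pos_of_lt (Nat.one_lt_two_pow hn.ne')
  have hc : UniformContinuous fun z => m • phiMap a b z :=
    CompactSpace.uniformContinuous_of_continuous ((continuous_phiMap a b).const_smul m)
  have ht : Tendsto (fun k : ℕ => 2 ^ k • (m • phiMap a b y)) atTop (𝓝 0) := by
    refine Metric.tendsto_atTop'.2 fun ε hε => ?_
    obtain ⟨δ, hδ, H⟩ := Metric.uniformContinuous_iff.1 hc ε hε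
    obtain ⟨K, hK⟩ := eventually_atTop.1 (Tendsto.eventually_lt_const hδ hy)
    refine ⟨K, fun k hk => ?_⟩
    have hO : (orbitSet (plpdm a b) x).Nonempty := ⟨x, 0, rfl⟩
    obtain ⟨o, ho, hd⟩ := (Metric.infDist_lt_iff hO).1 (hK k hk.le)
    have := H hd
    rwa [nsmul_phiMap_eq_zero_of_mem_orbitSet hx ho, phiMap_iterate, smul_comm] at this
  obtain ⟨k, hk⟩ := exists_two_pow_nsmul_eq_zero ht
  exact ⟨2 ^ k * m, by positivity, by rw [mul_smul, hk]⟩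

theorem UnitAddCircle.countable_torsion :
    {w : UnitAddCircle | ∃ N : ℕ, 0 < N ∧ N • w = 0}.Countable := by
  have h : {w : UnitAddCircle | ∃ N : ℕ, 0 < N ∧ N • w = 0} =
      ⋃ N : {N : ℕ // 0 < N}, {w : UnitAddCircle | N.1 • w = 0} := by
    ext w
    simp
  rw [h]
  exact countable_iUnion fun N => (AddCircle.finite_torsion 1 N.2).countable

theorem stmt8 (a : UnitAddCircle) (b : ℝ) (hb : b ∈ Set.Icc (0:ℝ) 1)
    (n : ℕ) (x : UnitAddCircle)
    (hx : IsAttractingPeriodicPt (plpdm a b) n x) :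
    ∀ z ∈ orbitSet (plpdm a b) x,
      ∀ y₁ ∈ connectedComponentIn (basin (plpdm a b) (orbitSet (plpdm a b) x)) z,
      ∀ y₂ ∈ connectedComponentIn (basin (plpdm a b) (orbitSet (plpdm a b) x)) z,
        phiMap a b y₁ = phiMap a b y₂ := by
  intro z _ y₁ hy₁ y₂ hy₂
  obtain ⟨hn, hper, -⟩ := hx
  refine UnitAddCircle.countable_torsion.isTotallyDisconnected _ ?_
    (isPreconnected_connectedComponentIn.image _ (continuous_phiMap a b).continuousOn)
    (mem_image_of_mem _ hy₁) (mem_image_of_mem _ hy₂)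
  rintro _ ⟨y, hy, rfl⟩
  exact exists_nsmul_phiMap_eq_zero_of_mem_basin hn hper (connectedComponentIn_subset _ _ hy)
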